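/- For every Noetherian space X, the lifted Hoare powerspace H₀X (the set of all closed subsets of X with the lower Vietoris topology) is a Noetherian space whose stature satisfies 1 + ||X|| ≤ ||H₀X|| ≤ ω^(||X||). -/

import Mathlib

open TopologicalSpace

/-- The ordinal rank of an element of a poset: defined by well-founded recursion as the least
ordinal strictly greater than the ranks of all strictly smaller elements (and `0` as a junk
value if the strict order is not well-founded). -/
noncomputable def wfRank {α : Type*} [Preorder α] (a : α) : Ordinal :=
  open Classical in
  if h : WellFoundedLT α then @IsWellFounded.rank α (· < ·) h a else 0

/-- The ordinal rank of a poset: the least ordinal strictly greater than the ranks of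
all its elements. -/
noncomputable def ordRank (α : Type*) [Preorder α] : Ordinal :=
  ⨆ a : α, wfRank a + 1

/-- The stature of a topological space: the rank of the whole space in the poset of
closed subsets ordered by inclusion (equivalently, the ordinal rank of the poset of proper
closed subsets). -/
noncomputable def stature (X : Type*) [TopologicalSpace X] : Ordinal :=
  wfRank (⊤ : Closeds X)

/-- The sobrification rank of a topological space: the ordinal rank of the poset of
irreducible closed subsets ordered by inclusion. -/
noncomputable def sobRank (X : Type*) [TopologicalSpace X] : Ordinal :=
  ordRank (IrreducibleCloseds X)

/-- The lifted Hoare powerspace of a topological space: the set of all closed subsets,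
equipped with the lower Vietoris topology generated by the sets
`◊U = {F closed | F ∩ U ≠ ∅}` for `U` open. -/
def HoareSpace (X : Type*) [TopologicalSpace X] : Type _ := Closeds X

instance HoareSpace.instTopologicalSpace (X : Type*) [TopologicalSpace X] :
    TopologicalSpace (HoareSpace X) :=
  TopologicalSpace.generateFrom
    { s : Set (Closeds X) | ∃ U : Set X, IsOpen U ∧
        s = { F : Closeds X | ((F : Set X) ∩ U).Nonempty } }

section WfRank

variable {α : Type*}

theorem wfRank_eq_rank [Preorder α] [h : WellFoundedLT α] (a : α) :
    wfRank a = IsWellFounded.rank (α := α) (· < ·) a := by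
  simp only [wfRank, dif_pos h]

theorem wfRank_strictMono [Preorder α] [WellFoundedLT α] :
    StrictMono (wfRank : α → Ordinal) := fun a b h => by
  rw [wfRank_eq_rank, wfRank_eq_rank]
  exact IsWellFounded.rank_lt_of_rel h

theorem wfRank_le_iff [Preorder α] [WellFoundedLT α] {a : α} {o : Ordinal} :
    wfRank a ≤ o ↔ ∀ b < a, wfRank b < o := by
  refine ⟨fun h b hb => (wfRank_strictMono hb).trans_le h, fun h => ?_⟩
  rw [wfRank_eq_rank, IsWellFounded.rank_eq]
  refine Ordinal.iSup_le fun b => Order.succ_le_of_lt ?_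
  rw [← wfRank_eq_rank]
  exact h b b.2

theorem exists_le_wfRank_of_lt [Preorder α] [WellFoundedLT α] {a : α} {o : Ordinal}
    (h : o < wfRank a) : ∃ b < a, o ≤ wfRank b := by
  by_contra! hb
  exact h.not_ge (wfRank_le_iff.2 hb)

end WfRank

section NaturalSum

/-- The natural (Hessenberg) sum of two ordinals: the least ordinal strictly greater than
`a' ⊕ b` and `a ⊕ b'` for all `a' < a` and `b' < b`. -/
noncomputable def naturalSum (a b : Ordinal.{u}) : Ordinal.{u} :=
  max (⨆ x : Set.Iio a, Order.succ (naturalSum x.1 b))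
    (⨆ x : Set.Iio b, Order.succ (naturalSum a x.1))
termination_by (a, b)
decreasing_by
  · exact Prod.Lex.left _ _ x.2
  · exact Prod.Lex.right _ x.2

theorem naturalSum_le_iff {a b c : Ordinal.{u}} :
    naturalSum a b ≤ c ↔
      (∀ a' < a, naturalSum a' b < c) ∧ ∀ b' < b, naturalSum a b' < c := by
  rw [naturalSum, max_le_iff, Ordinal.iSup_le_iff, Ordinal.iSup_le_iff]
  simp

theorem naturalSum_lt_left {a a' : Ordinal.{u}} (h : a' < a) (b : Ordinal.{u}) :
    naturalSum a' b < naturalSum a b :=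
  (naturalSum_le_iff.1 le_rfl).1 a' h

theorem naturalSum_lt_right (a : Ordinal.{u}) {b b' : Ordinal.{u}} (h : b' < b) :
    naturalSum a b' < naturalSum a b :=
  (naturalSum_le_iff.1 le_rfl).2 b' h

theorem naturalSum_mono {a a' b b' : Ordinal.{u}} (ha : a ≤ a') (hb : b ≤ b') :
    naturalSum a b ≤ naturalSum a' b' :=
  ((show StrictMono fun x => naturalSum x b from fun _ _ h => naturalSum_lt_left h b).monotone
    ha).trans
  ((show StrictMono fun y => naturalSum a' y from fun _ _ h => naturalSum_lt_right a' h).monotone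
    hb)

theorem exists_eq_mul_natCast_add {p a : Ordinal.{u}} {n : ℕ} {x : Ordinal.{u}} (hx : x < p)
    (h : a < p * n + x) :
    (∃ x' < x, a = p * n + x') ∨ ∃ m < n, ∃ x' < p, a = p * (m : ℕ) + x' := by
  have hlt : a < p * Order.succ (n : Ordinal) := by
    rw [Ordinal.mul_succ]
    exact h.trans (by gcongr)
  obtain ⟨q, hq, x', hx', rfl⟩ := Ordinal.lt_mul_iff.1 hlt
  rw [Order.lt_succ_iff] at hq
  obtain ⟨m, rfl⟩ := Ordinal.lt_omega0.1 (hq.trans_lt (Ordinal.natCast_lt_omega0 n))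
  rcases (Nat.cast_le.1 hq).eq_or_lt with rfl | hmn
  · exact Or.inl ⟨x', (add_lt_add_iff_left _).1 h, rfl⟩
  · exact Or.inr ⟨m, hmn, x', hx', rfl⟩

theorem mul_natCast_add_lt {p x : Ordinal.{u}} {m n : ℕ} (hx : x < p) (h : m < n) :
    p * m + x < p * n := by
  calc p * m + x < p * m + p := by gcongr
    _ = p * (m + 1 : ℕ) := by rw [Nat.cast_add_one, mul_add_one]
    _ ≤ p * n := by gcongr; exact h

theorem naturalSum_mul_natCast_add_le {p : Ordinal.{u}}
    (hp : Ordinal.IsPrincipal naturalSum p) (n m : ℕ) (x y : Ordinal.{u})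
    (hx : x < p) (hy : y < p) :
    naturalSum (p * n + x) (p * m + y) ≤ p * (n + m : ℕ) + naturalSum x y := by
  rw [naturalSum_le_iff]
  constructor
  · intro a ha
    obtain ⟨x', hx', rfl⟩ | ⟨n', hn', x', hx', rfl⟩ := exists_eq_mul_natCast_add hx ha
    · refine (naturalSum_mul_natCast_add_le hp n m x' y (hx'.trans hx) hy).trans_lt ?_
      gcongr
      exact naturalSum_lt_left hx' y
    · refine (naturalSum_mul_natCast_add_le hp n' m x' y hx' hy).trans_lt ?_
      exact (mul_natCast_add_lt (hp hx' hy) (by omega)).trans_le le_self_add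
  · intro b hb
    obtain ⟨y', hy', rfl⟩ | ⟨m', hm', y', hy', rfl⟩ := exists_eq_mul_natCast_add hy hb
    · refine (naturalSum_mul_natCast_add_le hp n m x y' hx (hy'.trans hy)).trans_lt ?_
      gcongr
      exact naturalSum_lt_right x hy'
    · refine (naturalSum_mul_natCast_add_le hp n m' x y' hx hy').trans_lt ?_
      exact (mul_natCast_add_lt (hp hx hy') (by omega)).trans_le le_self_add
termination_by (n + m, x, y)

theorem isPrincipal_naturalSum_omega0_opow (o : Ordinal.{u}) :
    Ordinal.IsPrincipal naturalSum (Ordinal.omega0 ^ o) := by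
  induction o using Ordinal.limitRecOn with
  | zero =>
    intro a b ha hb
    rw [Ordinal.opow_zero, Order.lt_one_iff] at *
    subst ha hb
    exact le_antisymm (naturalSum_le_iff.2 (by simp)) bot_le
  | add_one o ih =>
    intro a b ha hb
    have key : ∀ c < Ordinal.omega0 ^ (o + 1),
        ∃ n : ℕ, c ≤ Ordinal.omega0 ^ o * n + 0 := by
      intro c hc
      rw [Ordinal.opow_add_one, Ordinal.lt_mul_iff_of_isSuccLimit Ordinal.isSuccLimit_omega0] at hc
      obtain ⟨d, hd, hcd⟩ := hc
      obtain ⟨n, rfl⟩ := Ordinal.lt_omega0.1 hd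
      exact ⟨n, by simpa using hcd.le⟩
    obtain ⟨n, hn⟩ := key a ha
    obtain ⟨m, hm⟩ := key b hb
    have h0 : 0 < Ordinal.omega0 ^ o := Ordinal.opow_pos _ Ordinal.omega0_pos
    refine (naturalSum_mono hn hm).trans_lt
      ((naturalSum_mul_natCast_add_le ih n m 0 0 h0 h0).trans_lt ?_)
    refine (mul_natCast_add_lt (ih h0 h0) (Nat.lt_succ_self _)).trans ?_
    rw [Ordinal.opow_add_one]
    gcongr
    exact Ordinal.natCast_lt_omega0 _
  | limit o ho ih =>
    intro a b ha hb
    rw [Ordinal.lt_opow_of_isSuccLimit Ordinal.omega0_ne_zero ho] at *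
    obtain ⟨c, hc, hac⟩ := ha
    obtain ⟨d, hd, hbd⟩ := hb
    refine ⟨max c d, max_lt hc hd, ih _ (max_lt hc hd) ?_ ?_⟩
    · exact hac.trans_le (Ordinal.opow_le_opow_right Ordinal.omega0_pos (le_max_left _ _))
    · exact hbd.trans_le (Ordinal.opow_le_opow_right Ordinal.omega0_pos (le_max_right _ _))

theorem wfRank_sup_le {α : Type*} [DistribLattice α] [WellFoundedLT α] (a b : α) :
    wfRank (a ⊔ b) ≤ naturalSum (wfRank a) (wfRank b) := by
  suffices ∀ c a b : α, a ⊔ b = c → wfRank c ≤ naturalSum (wfRank a) (wfRank b) from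
    this _ a b rfl
  intro c
  induction c using WellFoundedLT.induction with
  | ind c ih =>
    rintro a b rfl
    rw [wfRank_le_iff]
    intro d hd
    have hsup : d ⊓ a ⊔ d ⊓ b = d := by rw [← inf_sup_left, inf_eq_left.2 hd.le]
    refine (ih d hd _ _ hsup).trans_lt ?_
    have hmono := (wfRank_strictMono (α := α)).monotone
    by_cases ha : a ≤ d
    · have hb : d ⊓ b < b := inf_lt_right.2 fun hb => hd.not_ge (sup_le ha hb)
      exact (naturalSum_mono (hmono inf_le_right) le_rfl).trans_lt
        (naturalSum_lt_right _ (wfRank_strictMono hb))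
    · exact (naturalSum_mono le_rfl (hmono inf_le_right)).trans_lt
        (naturalSum_lt_left (wfRank_strictMono (inf_lt_right.2 ha)) _)

end NaturalSum

namespace HoareSpace

variable {X : Type*} [TopologicalSpace X]

/-- The open set `◊U` of all closed sets that meet `U`. -/
def diamond (U : Set X) : Set (HoareSpace X) :=
  { F : Closeds X | ((F : Set X) ∩ U).Nonempty }

theorem isOpen_diamond {U : Set X} (hU : IsOpen U) : IsOpen (diamond U) :=
  isOpen_generateFrom_of_mem ⟨U, hU, rfl⟩

/-- The closed set of all closed subsets of `C`. -/
def box (C : Closeds X) : Closeds (HoareSpace X) where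
  carrier := (diamond (C : Set X)ᶜ)ᶜ
  isClosed' := (isOpen_diamond C.isClosed.isOpen_compl).isClosed_compl

theorem mem_box {C F : Closeds X} : (show HoareSpace X from F) ∈ box C ↔ F ≤ C := by
  change ¬((F : Set X) ∩ (C : Set X)ᶜ).Nonempty ↔ (F : Set X) ⊆ C
  rw [Set.inter_compl_nonempty_iff, not_not]

theorem specializes_of_le {F G : Closeds X} (h : F ≤ G) :
    Specializes (X := HoareSpace X) G F := by
  refine (nhds_generateFrom (α := HoareSpace X)).trans_le
    (le_trans ?_ (nhds_generateFrom (α := HoareSpace X)).ge)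
  refine le_iInf₂ fun s hs => iInf₂_le s ?_
  obtain ⟨hF, U, hU, rfl⟩ := hs
  obtain ⟨x, hx, hxU⟩ := hF
  exact ⟨⟨x, h hx, hxU⟩, U, hU, rfl⟩

theorem box_le {C : Closeds X} {𝓕 : Closeds (HoareSpace X)} (h : (C : HoareSpace X) ∈ 𝓕) :
    box C ≤ 𝓕 := fun _ hF => (specializes_of_le (mem_box.1 hF)).mem_closed 𝓕.isClosed h

theorem box_strictMono : StrictMono (box : Closeds X → Closeds (HoareSpace X)) := by
  intro C D h
  refine lt_of_le_of_ne (fun F hF => mem_box.2 ((mem_box.1 hF).trans h.le)) fun e => h.not_ge ?_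
  rw [← mem_box, e]
  exact mem_box.2 le_rfl

theorem box_top : box (⊤ : Closeds X) = ⊤ :=
  top_unique fun _ _ => mem_box.2 (le_top : _ ≤ (⊤ : Closeds X))

theorem bot_lt_box (C : Closeds X) : ⊥ < box C := by
  refine bot_lt_iff_ne_bot.2 fun e => ?_
  have : (C : HoareSpace X) ∈ box C := mem_box.2 le_rfl
  rw [e] at this
  exact this

instance [NoetherianSpace X] : NoetherianSpace (HoareSpace X) := by
  rw [noetherianSpace_iff_isCompact]
  intro S
  refine isCompact_generateFrom rfl fun P hP hS => ?_
  let 𝒰 : Set (Set X) := {U | IsOpen U ∧ diamond U ∈ P}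
  obtain ⟨T, hT, hTfin, hcov⟩ :=
    (NoetherianSpace.isCompact (⋃₀ 𝒰)).elim_finite_subcover_image (b := 𝒰) (c := id)
      (fun U hU => hU.1) Set.sUnion_eq_biUnion.le
  refine ⟨diamond '' T, ?_, hTfin.image _, ?_⟩
  · rintro _ ⟨U, hU, rfl⟩
    exact (hT hU).2
  · intro F hF
    obtain ⟨t, ht, hFt⟩ := hS hF
    obtain ⟨U, hU, rfl⟩ := hP ht
    obtain ⟨x, hxF, hxU⟩ := hFt
    obtain ⟨V, hV, hxV⟩ := Set.mem_iUnion₂.1 (hcov (Set.mem_sUnion_of_mem hxU ⟨hU, ht⟩))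
    exact ⟨_, Set.mem_image_of_mem _ hV, x, hxF, hxV⟩

theorem one_add_wfRank_le_wfRank_box [NoetherianSpace X] (C : Closeds X) :
    1 + wfRank C ≤ wfRank (box C) := by
  induction C using WellFoundedLT.induction with
  | ind C ih =>
    by_cases h0 : wfRank C = 0
    · rw [h0, add_zero, Order.one_le_iff_pos]
      exact bot_le.trans_lt (wfRank_strictMono (bot_lt_box C))
    · rw [Ordinal.add_le_iff h0]
      intro o ho
      obtain ⟨D, hD, hoD⟩ := exists_le_wfRank_of_lt ho
      exact ((add_le_add_right hoD 1).trans (ih D hD)).trans_lt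
        (wfRank_strictMono (box_strictMono hD))

theorem wfRank_box_le [NoetherianSpace X] (C : Closeds X) :
    wfRank (box C) ≤ Ordinal.omega0 ^ wfRank C := by
  induction C using WellFoundedLT.induction with
  | ind C ih =>
    rw [wfRank_le_iff]
    intro 𝓕 h𝓕
    have hmono := (wfRank_strictMono (α := Closeds (HoareSpace X))).monotone
    have hC : (C : HoareSpace X) ∈ (𝓕 : Set (HoareSpace X))ᶜ := fun hC =>
      h𝓕.not_ge (box_le hC)
    obtain ⟨_, ⟨T, ⟨hTfin, hT⟩, rfl⟩, hCT, hTF⟩ :=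
      (isTopologicalBasis_of_subbasis (α := HoareSpace X) rfl).exists_subset_of_mem_open hC
        𝓕.isClosed.isOpen_compl
    lift T to Finset (Set (HoareSpace X)) using hTfin
    refine (hmono (show 𝓕 ≤ T.sup fun t => Closeds.closure tᶜ ⊓ box C from ?_)).trans_lt ?_
    · intro F hF
      have hFT : F ∉ ⋂₀ (T : Set (Set (HoareSpace X))) := fun h => hTF h hF
      simp only [Set.mem_sInter, not_forall] at hFT
      obtain ⟨t, ht, hFt⟩ := hFT
      exact Finset.le_sup (f := fun t => Closeds.closure tᶜ ⊓ box C) ht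
        ⟨subset_closure hFt, h𝓕.le hF⟩
    · refine Finset.sup_induction (p := fun 𝓖 => wfRank 𝓖 < Ordinal.omega0 ^ wfRank C) ?_ ?_ ?_
      · refine (wfRank_le_iff.2 fun b hb => (not_lt_bot hb).elim).trans_lt
          (Ordinal.opow_pos _ Ordinal.omega0_pos)
      · exact fun a ha b hb =>
          (wfRank_sup_le a b).trans_lt (isPrincipal_naturalSum_omega0_opow _ ha hb)
      · intro t ht
        obtain ⟨U, hU, rfl⟩ := hT ht
        let D : Closeds X := C ⊓ ⟨Uᶜ, hU.isClosed_compl⟩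
        have hD : D < C := by
          refine inf_lt_left.2 fun h => ?_
          obtain ⟨x, hxC, hxU⟩ := hCT _ ht
          exact h hxC hxU
        refine (hmono (show _ ≤ box D from ?_)).trans_lt ((ih D hD).trans_lt ?_)
        · rintro F ⟨hFU, hFC⟩
          have hFU' : F ∈ (diamond U)ᶜ := (isOpen_diamond hU).isClosed_compl.closure_subset hFU
          exact mem_box.2 (le_inf (mem_box.1 hFC) fun x hxF hxU => hFU' ⟨x, hxF, hxU⟩)
        · exact (Ordinal.opow_lt_opow_iff_right Ordinal.one_lt_omega0).2 (wfRank_strictMono hD)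

end HoareSpace

/-- For every Noetherian space `X`, the lifted Hoare powerspace `H₀X` is Noetherian and its
stature satisfies `1 + ‖X‖ ≤ ‖H₀X‖ ≤ ω ^ ‖X‖`. -/
theorem stature_hoare (X : Type u) [TopologicalSpace X] [NoetherianSpace X] :
    NoetherianSpace (HoareSpace X) ∧
    1 + stature X ≤ stature (HoareSpace X) ∧
    stature (HoareSpace X) ≤ Ordinal.omega0 ^ stature X := by
  exact ⟨inferInstance,
    (HoareSpace.one_add_wfRank_le_wfRank_box ⊤).trans_eq (congrArg wfRank HoareSpace.box_top),
    (congrArg wfRank HoareSpace.box_top).ge.trans (HoareSpace.wfRank_box_le ⊤)⟩
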